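/- arXiv:2506.23045 — 5 statements merged into one kernel-verified Lean document; each statement's English description precedes it below -/
import Mathlib

section
/- Let M, N be positive integers, let h : ℤ → ℤ → ℂ be MN-periodic in both arguments (h(k + MN, l) = h(k, l) and h(k, l + MN) = h(k, l) for all k, l), and let x : ℤ → ℤ → ℂ be quasi-periodic with periods (M, N). Define the MN-periodic discrete twisted convolution y : ℤ → ℤ → ℂ by y(k, l) = Σ_{k'=0}^{MN−1} Σ_{l'=0}^{MN−1} h(k', l') · x(k − k', l − l') · exp(2πi · l' · (k − k') / (M·N)). Then y is also quasi-periodic with periods (M, N). -/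
/-- The MN-periodic discrete twisted convolution of an MN-periodic
channel with a quasi-periodic signal is quasi-periodic with periods (M, N). -/
theorem stmt4 (M N : ℕ) (hM : 0 < M) (hN : 0 < N)
    (h : ℤ → ℤ → ℂ)
    (hper : ∀ k l : ℤ, h (k + (M : ℤ) * (N : ℤ)) l = h k l ∧ h k (l + (M : ℤ) * (N : ℤ)) = h k l)
    (x : ℤ → ℤ → ℂ)
    (hqp : ∀ k l n m : ℤ, x (k + n * (M : ℤ)) (l + m * (N : ℤ)) =
      Complex.exp (2 * (Real.pi : ℂ) * Complex.I * (n : ℂ) * (l : ℂ) / (N : ℂ)) * x k l)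
    (y : ℤ → ℤ → ℂ)
    (hy : ∀ k l : ℤ, y k l =
      ∑ k' ∈ Finset.range (M * N), ∑ l' ∈ Finset.range (M * N),
        h (k' : ℤ) (l' : ℤ) * x (k - (k' : ℤ)) (l - (l' : ℤ)) *
          Complex.exp (2 * (Real.pi : ℂ) * Complex.I * (l' : ℂ) * ((k - (k' : ℤ) : ℤ) : ℂ) /
            ((M : ℂ) * (N : ℂ)))) :
    ∀ k l n m : ℤ, y (k + n * (M : ℤ)) (l + m * (N : ℤ)) =
      Complex.exp (2 * (Real.pi : ℂ) * Complex.I * (n : ℂ) * (l : ℂ) / (N : ℂ)) * y k l := by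
  intro k l n m
  have hM' : (M : ℂ) ≠ 0 := by exact_mod_cast hM.ne'
  have hN' : (N : ℂ) ≠ 0 := by exact_mod_cast hN.ne'
  rw [hy, hy, Finset.mul_sum]
  refine Finset.sum_congr rfl fun k' _ => ?_
  rw [Finset.mul_sum]
  refine Finset.sum_congr rfl fun l' _ => ?_
  have e1 : k + n * (M : ℤ) - (k' : ℤ) = (k - k') + n * (M : ℤ) := by ring
  have e2 : l + m * (N : ℤ) - (l' : ℤ) = (l - l') + m * (N : ℤ) := by ring
  rw [e1, e2, hqp]
  have key : Complex.exp (2 * (Real.pi : ℂ) * Complex.I * (n : ℂ) * ((l - (l' : ℤ) : ℤ) : ℂ) / (N : ℂ)) *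
      Complex.exp (2 * (Real.pi : ℂ) * Complex.I * (l' : ℂ) *
        ((k - (k' : ℤ) + n * (M : ℤ) : ℤ) : ℂ) / ((M : ℂ) * (N : ℂ))) =
      Complex.exp (2 * (Real.pi : ℂ) * Complex.I * (n : ℂ) * (l : ℂ) / (N : ℂ)) *
      Complex.exp (2 * (Real.pi : ℂ) * Complex.I * (l' : ℂ) * ((k - (k' : ℤ) : ℤ) : ℂ) /
            ((M : ℂ) * (N : ℂ))) := by
    rw [← Complex.exp_add, ← Complex.exp_add]
    congr 1
    push_cast
    field_simp
    ring
  linear_combination (h k' l' * x (k - k') (l - l')) * key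
end

section
/- (Main Theorem, noiseless form.) Let M, N be positive integers, let h : ℤ → ℤ → ℂ be MN-periodic in both arguments, and let x : ℤ → ℤ → ℂ be quasi-periodic with periods (M, N) with IDFZT S(i) = (1/√M) · Σ_{k=0}^{M−1} x(k, i) · exp(−2πi · i · k / (M·N)). Define y(k, l) = Σ_{k'=0}^{MN−1} Σ_{l'=0}^{MN−1} h(k', l') · x(k − k', l − l') · exp(2πi · l' · (k − k') / (M·N)) and its IDFZT Y(i) = (1/√M) · Σ_{k=0}^{M−1} y(k, i) · exp(−2πi · i · k / (M·N)). Then for all i ∈ ℤ: Y(i) = Σ_{k'=0}^{MN−1} Σ_{l'=0}^{MN−1} h(k', l') · S(i − l') · exp(−2πi · i · k' / (M·N)). -/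
theorem shift_sum (M : ℕ) (g : ℤ → ℂ) (hg : ∀ k, g (k + M) = g k) (c : ℕ) :
    ∑ k ∈ Finset.range M, g ((k : ℤ) - (c : ℤ)) = ∑ k ∈ Finset.range M, g (k : ℤ) := by
  induction c with
  | zero => simp
  | succ c ih =>
    rw [← ih]
    have h1 := Finset.sum_range_succ (fun k : ℕ => g ((k : ℤ) - ((c + 1 : ℕ) : ℤ))) M
    have h2 := Finset.sum_range_succ' (fun k : ℕ => g ((k : ℤ) - ((c + 1 : ℕ) : ℤ))) M
    rw [h1] at h2
    have h3 : g ((M : ℤ) - ((c + 1 : ℕ) : ℤ)) = g (((0 : ℕ) : ℤ) - ((c + 1 : ℕ) : ℤ)) := by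
      rw [← hg (((0 : ℕ) : ℤ) - ((c + 1 : ℕ) : ℤ))]
      exact congrArg g (by push_cast; ring)
    rw [h3] at h2
    rw [add_right_cancel h2]
    refine Finset.sum_congr rfl fun k _ => ?_
    congr 1
    push_cast
    ring

/-- Main theorem, noiseless: the IDFZT of the twisted-convolution
output satisfies Y(i) = Σ_{k'} Σ_{l'} h(k',l')·S(i−l')·exp(−2πi·i·k'/(MN)). -/
theorem stmt5 (M N : ℕ) (hM : 0 < M) (hN : 0 < N)
    (h : ℤ → ℤ → ℂ)
    (hper : ∀ k l : ℤ, h (k + (M : ℤ) * (N : ℤ)) l = h k l ∧ h k (l + (M : ℤ) * (N : ℤ)) = h k l)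
    (x : ℤ → ℤ → ℂ)
    (hqp : ∀ k l n m : ℤ, x (k + n * (M : ℤ)) (l + m * (N : ℤ)) =
      Complex.exp (2 * (Real.pi : ℂ) * Complex.I * (n : ℂ) * (l : ℂ) / (N : ℂ)) * x k l)
    (S : ℤ → ℂ)
    (hS : ∀ i : ℤ, S i = (1 / (Real.sqrt M : ℂ)) *
      ∑ k ∈ Finset.range M, x (k : ℤ) i *
        Complex.exp (-(2 * (Real.pi : ℂ) * Complex.I) * (i : ℂ) * (k : ℂ) / ((M : ℂ) * (N : ℂ))))
    (y : ℤ → ℤ → ℂ)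
    (hy : ∀ k l : ℤ, y k l =
      ∑ k' ∈ Finset.range (M * N), ∑ l' ∈ Finset.range (M * N),
        h (k' : ℤ) (l' : ℤ) * x (k - (k' : ℤ)) (l - (l' : ℤ)) *
          Complex.exp (2 * (Real.pi : ℂ) * Complex.I * (l' : ℂ) * ((k - (k' : ℤ) : ℤ) : ℂ) /
            ((M : ℂ) * (N : ℂ))))
    (Y : ℤ → ℂ)
    (hY : ∀ i : ℤ, Y i = (1 / (Real.sqrt M : ℂ)) *
      ∑ k ∈ Finset.range M, y (k : ℤ) i *
        Complex.exp (-(2 * (Real.pi : ℂ) * Complex.I) * (i : ℂ) * (k : ℂ) / ((M : ℂ) * (N : ℂ)))) :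
    ∀ i : ℤ, Y i =
      ∑ k' ∈ Finset.range (M * N), ∑ l' ∈ Finset.range (M * N),
        h (k' : ℤ) (l' : ℤ) * S (i - (l' : ℤ)) *
          Complex.exp (-(2 * (Real.pi : ℂ) * Complex.I) * (i : ℂ) * (k' : ℂ) /
            ((M : ℂ) * (N : ℂ))) := by
  intro i
  have hM0 : (M : ℂ) ≠ 0 := by exact_mod_cast hM.ne'
  have hN0 : (N : ℂ) ≠ 0 := by exact_mod_cast hN.ne'
  have hg : ∀ j k : ℤ, x (k + M) j *
      Complex.exp (-(2 * (Real.pi : ℂ) * Complex.I) * (j : ℂ) * ((k + M : ℤ) : ℂ) /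
        ((M : ℂ) * (N : ℂ))) = x k j *
      Complex.exp (-(2 * (Real.pi : ℂ) * Complex.I) * (j : ℂ) * (k : ℂ) /
        ((M : ℂ) * (N : ℂ))) := by
    intro j k
    have e := hqp k j 1 0
    simp only [one_mul, zero_mul, add_zero] at e
    rw [e, mul_comm (Complex.exp _) (x k j), mul_assoc, ← Complex.exp_add]
    congr 2
    push_cast
    field_simp
    ring
  rw [hY]
  simp only [hy, Finset.sum_mul]
  rw [Finset.sum_comm, Finset.mul_sum]
  refine Finset.sum_congr rfl fun k' _ => ?_
  rw [Finset.sum_comm, Finset.mul_sum]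
  refine Finset.sum_congr rfl fun l' _ => ?_
  have sh := shift_sum M (fun k : ℤ => x k (i - l') *
      Complex.exp (-(2 * (Real.pi : ℂ) * Complex.I) * ((i - l' : ℤ) : ℂ) * (k : ℂ) /
        ((M : ℂ) * (N : ℂ)))) (hg (i - l')) k'
  simp only [Int.cast_natCast] at sh
  rw [hS, ← sh, Finset.mul_sum, Finset.mul_sum, Finset.mul_sum,
    Finset.sum_mul]
  refine Finset.sum_congr rfl fun k _ => ?_
  have e : Complex.exp (2 * (Real.pi : ℂ) * Complex.I * (l' : ℂ) * (((k : ℤ) - (k' : ℤ) : ℤ) : ℂ) /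
            ((M : ℂ) * (N : ℂ))) *
      Complex.exp (-(2 * (Real.pi : ℂ) * Complex.I) * (i : ℂ) * (k : ℂ) / ((M : ℂ) * (N : ℂ))) =
      Complex.exp (-(2 * (Real.pi : ℂ) * Complex.I) * ((i - l' : ℤ) : ℂ) *
        (((k : ℤ) - (k' : ℤ) : ℤ) : ℂ) / ((M : ℂ) * (N : ℂ))) *
      Complex.exp (-(2 * (Real.pi : ℂ) * Complex.I) * (i : ℂ) * (k' : ℂ) /
        ((M : ℂ) * (N : ℂ))) := by
    rw [← Complex.exp_add, ← Complex.exp_add]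
    congr 1
    push_cast
    ring
  linear_combination (1 / (Real.sqrt M : ℂ)) * h k' l' * x (k - k') (i - l') * e
end

section
/- (Inversion of the IDZT by the DZT.) Let M, N be positive integers and let x : ℤ → ℤ → ℂ be quasi-periodic with periods (M, N). Define the time-domain sequence a : ℤ → ℂ by a(n) = (1/√N) · Σ_{l=0}^{N−1} x(n, l). Then the discrete Zak transform of a recovers x: for all k, l ∈ ℤ, (1/√N) · Σ_{q=0}^{N−1} a(k + q·M) · exp(−2πi · q · l / N) = x(k, l). -/
/-- Orthogonality of characters of the cyclic group of order `N`. -/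
theorem stmt7_char_sum (N : ℕ) (hN : 0 < N) (d : ℤ) :
    ∑ q ∈ Finset.range N,
      Complex.exp (2 * (Real.pi : ℂ) * Complex.I * (q : ℂ) * (d : ℂ) / (N : ℂ)) =
      if (N : ℤ) ∣ d then (N : ℂ) else 0 := by
  have hN0 : (N : ℂ) ≠ 0 := by exact_mod_cast hN.ne'
  have hpi : (2 * (Real.pi : ℂ) * Complex.I) ≠ 0 := Complex.two_pi_I_ne_zero
  have hpow : ∀ q : ℕ,
      Complex.exp (2 * (Real.pi : ℂ) * Complex.I * (q : ℂ) * (d : ℂ) / (N : ℂ)) =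
      Complex.exp (2 * (Real.pi : ℂ) * Complex.I * (d : ℂ) / (N : ℂ)) ^ q := by
    intro q
    rw [← Complex.exp_nat_mul]
    congr 1
    ring
  simp only [hpow]
  split_ifs with h
  · obtain ⟨c, rfl⟩ := h
    have h1 : Complex.exp (2 * (Real.pi : ℂ) * Complex.I * (((N : ℤ) * c : ℤ) : ℂ) / (N : ℂ)) = 1 := by
      rw [Complex.exp_eq_one_iff]
      refine ⟨c, ?_⟩
      push_cast
      field_simp
    rw [h1]
    simp
  · have h1 : Complex.exp (2 * (Real.pi : ℂ) * Complex.I * (d : ℂ) / (N : ℂ)) ≠ 1 := by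
      intro h1
      rw [Complex.exp_eq_one_iff] at h1
      obtain ⟨c, hc⟩ := h1
      apply h
      refine ⟨c, ?_⟩
      rw [div_eq_iff hN0] at hc
      have h2 : (d : ℂ) = (N : ℂ) * c := by
        apply mul_left_cancel₀ hpi
        rw [hc]
        ring
      exact_mod_cast h2
    rw [geom_sum_eq h1, ← hpow]
    have h2 : Complex.exp (2 * (Real.pi : ℂ) * Complex.I * (N : ℂ) * (d : ℂ) / (N : ℂ)) = 1 := by
      rw [Complex.exp_eq_one_iff]
      refine ⟨d, ?_⟩
      field_simp
    rw [h2]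
    simp

/-- The DZT inverts the IDZT on quasi-periodic functions. -/
theorem stmt7 (M N : ℕ) (hM : 0 < M) (hN : 0 < N)
    (x : ℤ → ℤ → ℂ)
    (hqp : ∀ k l n m : ℤ, x (k + n * (M : ℤ)) (l + m * (N : ℤ)) =
      Complex.exp (2 * (Real.pi : ℂ) * Complex.I * (n : ℂ) * (l : ℂ) / (N : ℂ)) * x k l)
    (a : ℤ → ℂ)
    (ha : ∀ n : ℤ, a n = (1 / (Real.sqrt N : ℂ)) * ∑ l ∈ Finset.range N, x n (l : ℤ)) :
    ∀ k l : ℤ,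
      (1 / (Real.sqrt N : ℂ)) *
        ∑ q ∈ Finset.range N, a (k + (q : ℤ) * (M : ℤ)) *
          Complex.exp (-(2 * (Real.pi : ℂ) * Complex.I) * (q : ℂ) * (l : ℂ) / (N : ℂ))
      = x k l := by
  intro k l
  have hN0 : (N : ℂ) ≠ 0 := by exact_mod_cast hN.ne'
  have hNz : (N : ℤ) ≠ 0 := by exact_mod_cast hN.ne'
  have hs : (1 / (Real.sqrt N : ℂ)) * (1 / (Real.sqrt N : ℂ)) = 1 / (N : ℂ) := by
    have h : (Real.sqrt N : ℂ) * (Real.sqrt N : ℂ) = (N : ℂ) := by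
      rw [← Complex.ofReal_mul, Real.mul_self_sqrt (Nat.cast_nonneg N)]
      simp
    rw [div_mul_div_comm, h, one_mul]
  have hterm : ∀ q : ℕ, a (k + (q : ℤ) * (M : ℤ)) *
      Complex.exp (-(2 * (Real.pi : ℂ) * Complex.I) * (q : ℂ) * (l : ℂ) / (N : ℂ)) =
      (1 / (Real.sqrt N : ℂ)) * ∑ j ∈ Finset.range N, x k (j : ℤ) *
        Complex.exp (2 * (Real.pi : ℂ) * Complex.I * (q : ℂ) * (((j : ℤ) - l : ℤ) : ℂ) / (N : ℂ)) := by
    intro q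
    rw [ha, mul_assoc, Finset.sum_mul]
    congr 1
    refine Finset.sum_congr rfl fun j _ => ?_
    have h := hqp k j q 0
    rw [zero_mul, add_zero] at h
    rw [h, mul_comm _ (x k j), mul_assoc, ← Complex.exp_add]
    congr 2
    push_cast
    ring
  simp only [hterm]
  rw [← Finset.mul_sum, ← mul_assoc, hs, Finset.sum_comm]
  simp only [← Finset.mul_sum, stmt7_char_sum N hN]
  have hr0 := Int.emod_nonneg l hNz
  have hrN := Int.emod_lt_of_pos l (by exact_mod_cast hN : (0 : ℤ) < N)
  obtain ⟨r, hr⟩ := Int.eq_ofNat_of_zero_le hr0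
  have hrlt : r < N := by
    rw [hr] at hrN
    exact_mod_cast hrN
  have hx : x k l = x k (r : ℤ) := by
    have h := hqp k (l % N) 0 (l / N)
    rw [Int.emod_add_ediv_mul] at h
    simpa [hr] using h
  rw [Finset.sum_eq_single r]
  · have hd : (N : ℤ) ∣ (r : ℤ) - l := by
      refine ⟨-(l / N), ?_⟩
      have := Int.emod_add_mul_ediv l N
      rw [hr] at this
      linarith
    rw [if_pos hd, hx]
    field_simp
  · intro j hj hjr
    rw [if_neg, mul_zero]
    intro hd
    apply hjr
    have h1 : (j : ℤ) % N = l % N := Int.emod_eq_emod_iff_emod_sub_eq_zero.mpr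
      (Int.emod_eq_zero_of_dvd hd)
    rw [hr, Int.emod_eq_of_lt (by positivity) (by exact_mod_cast Finset.mem_range.mp hj)] at h1
    exact_mod_cast h1
  · intro h
    exact absurd (Finset.mem_range.mpr hrlt) h
end

section
/- (Inversion of the IDFZT by the DFZT.) Let M, N be positive integers, let x : ℤ → ℤ → ℂ be quasi-periodic with periods (M, N), and let S : ℤ → ℂ be its IDFZT, S(i) = (1/√M) · Σ_{k=0}^{M−1} x(k, i) · exp(−2πi · i · k / (M·N)). Then for all k, l ∈ ℤ: (1/√M) · Σ_{p=0}^{M−1} S(l + p·N) · exp(2πi · (l + p·N) · k / (M·N)) = x(k, l). -/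
lemma geom_aux (M : ℕ) (hM : 0 < M) (d : ℤ) (hd : ¬ (M : ℤ) ∣ d) :
    ∑ p ∈ Finset.range M, Complex.exp (2 * (Real.pi : ℂ) * Complex.I * (d : ℂ) / (M : ℂ)) ^ p = 0 := by
  have hM' : (M : ℂ) ≠ 0 := by exact_mod_cast hM.ne'
  have h1 : Complex.exp (2 * (Real.pi : ℂ) * Complex.I * (d : ℂ) / (M : ℂ)) ≠ 1 := by
    intro h
    rw [Complex.exp_eq_one_iff] at h
    obtain ⟨n, hn⟩ := h
    apply hd
    refine ⟨n, ?_⟩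
    have hpi := Complex.two_pi_I_ne_zero
    rw [div_eq_iff hM'] at hn
    have : (2 * (Real.pi : ℂ) * Complex.I) * (d : ℂ) =
        (2 * (Real.pi : ℂ) * Complex.I) * ((M : ℂ) * n) := by rw [hn]; ring
    have := mul_left_cancel₀ hpi this
    exact_mod_cast this
  rw [geom_sum_eq h1, ← Complex.exp_nat_mul]
  have : (M : ℂ) * (2 * (Real.pi : ℂ) * Complex.I * (d : ℂ) / (M : ℂ)) =
      d * (2 * (Real.pi : ℂ) * Complex.I) := by field_simp
  rw [this, Complex.exp_int_mul_two_pi_mul_I]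
  simp

/-- The DFZT inverts the IDFZT on quasi-periodic functions. -/
theorem stmt8 (M N : ℕ) (hM : 0 < M) (hN : 0 < N)
    (x : ℤ → ℤ → ℂ)
    (hqp : ∀ k l n m : ℤ, x (k + n * (M : ℤ)) (l + m * (N : ℤ)) =
      Complex.exp (2 * (Real.pi : ℂ) * Complex.I * (n : ℂ) * (l : ℂ) / (N : ℂ)) * x k l)
    (S : ℤ → ℂ)
    (hS : ∀ i : ℤ, S i = (1 / (Real.sqrt M : ℂ)) *
      ∑ k ∈ Finset.range M, x (k : ℤ) i *
        Complex.exp (-(2 * (Real.pi : ℂ) * Complex.I) * (i : ℂ) * (k : ℂ) / ((M : ℂ) * (N : ℂ)))) :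
    ∀ k l : ℤ,
      (1 / (Real.sqrt M : ℂ)) *
        ∑ p ∈ Finset.range M, S (l + (p : ℤ) * (N : ℤ)) *
          Complex.exp (2 * (Real.pi : ℂ) * Complex.I * ((l + (p : ℤ) * (N : ℤ) : ℤ) : ℂ) * (k : ℂ) /
            ((M : ℂ) * (N : ℂ)))
      = x k l := by
  intro k l
  have hM' : (M : ℂ) ≠ 0 := by exact_mod_cast hM.ne'
  have hN' : (N : ℂ) ≠ 0 := by exact_mod_cast hN.ne'
  have hMz : (0 : ℤ) < M := by exact_mod_cast hM
  have hsq : (1 / (Real.sqrt M : ℂ)) * (1 / (Real.sqrt M : ℂ)) = 1 / (M : ℂ) := by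
    rw [div_mul_div_comm, ← Complex.ofReal_mul, Real.mul_self_sqrt (by positivity)]
    simp
  have hper : ∀ j m : ℤ, x j (l + m * (N : ℤ)) = x j l := by
    intro j m
    have := hqp j l 0 m
    simpa using this
  obtain ⟨j0, hj0⟩ := Int.eq_ofNat_of_zero_le (Int.emod_nonneg k hMz.ne')
  have hj0lt : j0 < M := by
    have := Int.emod_lt_of_pos k hMz
    omega
  have hk : k = (j0 : ℤ) + (k / M) * (M : ℤ) := by
    have := Int.emod_add_mul_ediv k M
    rw [hj0] at this
    linarith [mul_comm (k / (M : ℤ)) (M : ℤ)]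
  generalize k / (M : ℤ) = q at hk
  have key : ∀ p : ℕ, S (l + (p : ℤ) * (N : ℤ)) *
          Complex.exp (2 * (Real.pi : ℂ) * Complex.I * ((l + (p : ℤ) * (N : ℤ) : ℤ) : ℂ) * (k : ℂ) /
            ((M : ℂ) * (N : ℂ))) =
      (1 / (Real.sqrt M : ℂ)) * ∑ j ∈ Finset.range M, (x (j : ℤ) l *
        Complex.exp (2 * (Real.pi : ℂ) * Complex.I * l * ((k - j : ℤ) : ℂ) / ((M : ℂ) * (N : ℂ)))) *
        Complex.exp (2 * (Real.pi : ℂ) * Complex.I * ((k - j : ℤ) : ℂ) / (M : ℂ)) ^ p := by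
    intro p
    rw [hS, mul_assoc, Finset.sum_mul]
    congr 1
    refine Finset.sum_congr rfl fun j _ => ?_
    rw [hper, ← Complex.exp_nat_mul, mul_assoc (x (j : ℤ) l), mul_assoc (x (j : ℤ) l), ← Complex.exp_add, ← Complex.exp_add]
    congr 2
    push_cast
    field_simp
    ring
  rw [Finset.sum_congr rfl fun p _ => key p, ← Finset.mul_sum, ← mul_assoc, hsq, Finset.sum_comm]
  simp_rw [← Finset.mul_sum]
  rw [Finset.sum_eq_single j0]
  · have hkj : k - (j0 : ℤ) = q * M := by linarith
    have hone : Complex.exp (2 * (Real.pi : ℂ) * Complex.I * ((k - j0 : ℤ) : ℂ) / (M : ℂ)) = 1 := by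
      rw [hkj, ← Complex.exp_int_mul_two_pi_mul_I q]
      congr 1
      push_cast
      field_simp
    have hx : x k l = Complex.exp (2 * (Real.pi : ℂ) * Complex.I * (q : ℂ) * (l : ℂ) / (N : ℂ)) *
        x j0 l := by
      have := hqp j0 l q 0
      rw [← hk] at this
      simpa using this
    have he : 2 * (Real.pi : ℂ) * Complex.I * l * ((k - j0 : ℤ) : ℂ) / ((M : ℂ) * (N : ℂ)) =
        2 * (Real.pi : ℂ) * Complex.I * (q : ℂ) * (l : ℂ) / (N : ℂ) := by
      rw [hkj]
      push_cast
      field_simp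
    rw [hone, hx, he]
    simp only [one_pow, Finset.sum_const, Finset.card_range, nsmul_eq_mul, mul_one]
    field_simp
  · intro j hj hne
    rw [geom_aux M hM, mul_zero]
    rintro ⟨c, hc⟩
    have hjlt := Finset.mem_range.mp hj
    apply hne
    have h1 : (j : ℤ) = j0 + M * (q - c) := by linarith
    have h2 : (j : ℤ) % M = (j0 : ℤ) % M := by rw [h1, Int.add_mul_emod_self_left]
    rw [Int.emod_eq_of_lt (by omega) (by omega), Int.emod_eq_of_lt (by omega) (by omega)] at h2
    exact_mod_cast h2
  · intro h
    exact absurd (Finset.mem_range.mpr hj0lt) h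
end

section
/- (Equivalence of the infinite and MN-periodic twisted convolutions.) Let M, N be positive integers, let x : ℤ → ℤ → ℂ be quasi-periodic with periods (M, N), and let h_dd : ℤ → ℤ → ℂ have finite support. Define the MN-periodization h(k, l) = Σ_{n, m ∈ ℤ} h_dd(k + n·M·N, l + m·M·N) (a finite sum by finite support). Then for all k, l ∈ ℤ: Σ_{k', l' ∈ ℤ} h_dd(k', l') · x(k − k', l − l') · exp(2πi · l' · (k − k') / (M·N)) = Σ_{k'=0}^{MN−1} Σ_{l'=0}^{MN−1} h(k', l') · x(k − k', l − l') · exp(2πi · l' · (k − k') / (M·N)). -/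
/-- The infinite twisted convolution with a finitely supported
channel equals the MN-periodic twisted convolution with its MN-periodization. -/
theorem stmt9 (M N : ℕ) (hM : 0 < M) (hN : 0 < N)
    (x : ℤ → ℤ → ℂ)
    (hqp : ∀ k l n m : ℤ, x (k + n * (M : ℤ)) (l + m * (N : ℤ)) =
      Complex.exp (2 * (Real.pi : ℂ) * Complex.I * (n : ℂ) * (l : ℂ) / (N : ℂ)) * x k l)
    (h_dd : ℤ → ℤ → ℂ)
    (hfin : (Function.support fun p : ℤ × ℤ => h_dd p.1 p.2).Finite)
    (h : ℤ → ℤ → ℂ)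
    (hh : ∀ k l : ℤ, h k l =
      ∑' p : ℤ × ℤ, h_dd (k + p.1 * ((M : ℤ) * (N : ℤ))) (l + p.2 * ((M : ℤ) * (N : ℤ)))) :
    ∀ k l : ℤ,
      (∑' p : ℤ × ℤ, h_dd p.1 p.2 * x (k - p.1) (l - p.2) *
        Complex.exp (2 * (Real.pi : ℂ) * Complex.I * (p.2 : ℂ) * ((k - p.1 : ℤ) : ℂ) /
          ((M : ℂ) * (N : ℂ))))
      = ∑ k' ∈ Finset.range (M * N), ∑ l' ∈ Finset.range (M * N),
          h (k' : ℤ) (l' : ℤ) * x (k - (k' : ℤ)) (l - (l' : ℤ)) *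
            Complex.exp (2 * (Real.pi : ℂ) * Complex.I * (l' : ℂ) * ((k - (k' : ℤ) : ℤ) : ℂ) /
              ((M : ℂ) * (N : ℂ))) := by
  intro k l
  set L : ℕ := M * N with hL
  have hLpos : 0 < L := Nat.mul_pos hM hN
  have : NeZero L := ⟨hLpos.ne'⟩
  have hMc : (M : ℂ) ≠ 0 := by exact_mod_cast hM.ne'
  have hNc : (N : ℂ) ≠ 0 := by exact_mod_cast hN.ne'
  set g : ℤ → ℤ → ℂ := fun a b => x (k - a) (l - b) *
        Complex.exp (2 * (Real.pi : ℂ) * Complex.I * (b : ℂ) * ((k - a : ℤ) : ℂ) /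
          ((M : ℂ) * (N : ℂ))) with hg
  have hper : ∀ a b n m : ℤ, g (a + n * ((M : ℤ) * (N : ℤ))) (b + m * ((M : ℤ) * (N : ℤ)))
      = g a b := by
    intro a b n m
    have h1 := hqp (k - a) (l - b) (-(n * N)) (-(m * M))
    have e1 : k - (a + n * ((M : ℤ) * (N : ℤ))) = k - a + -(n * N) * (M : ℤ) := by ring
    have e2 : l - (b + m * ((M : ℤ) * (N : ℤ))) = l - b + -(m * M) * (N : ℤ) := by ring
    simp only [hg]
    rw [e1, e2, h1]
    have h2 : Complex.exp (2 * (Real.pi : ℂ) * Complex.I * ((-(n * N) : ℤ) : ℂ) *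
        ((l - b : ℤ) : ℂ) / (N : ℂ)) = 1 := by
      rw [Complex.exp_eq_one_iff]
      refine ⟨-n * (l - b), ?_⟩
      push_cast
      field_simp
    rw [h2, one_mul]
    congr 1
    rw [Complex.exp_eq_exp_iff_exists_int]
    refine ⟨m * (k - a) - n * b - n * m * M * N, ?_⟩
    push_cast
    field_simp
    ring
  have hF : ∀ a b : ℤ, h_dd a b * x (k - a) (l - b) *
        Complex.exp (2 * (Real.pi : ℂ) * Complex.I * (b : ℂ) * ((k - a : ℤ) : ℂ) /
          ((M : ℂ) * (N : ℂ))) = h_dd a b * g a b := fun a b => mul_assoc _ _ _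
  let e : (Fin L × Fin L) × (ℤ × ℤ) ≃ ℤ × ℤ :=
    ((Equiv.prodComm _ _).trans (Equiv.prodProdProdComm ℤ ℤ (Fin L) (Fin L))).trans
      (Equiv.prodCongr (Int.divModEquiv L).symm (Int.divModEquiv L).symm)
  have he : ∀ q p, e (q, p) = (((q.1 : ℕ) : ℤ) + p.1 * ((M : ℤ) * (N : ℤ)),
      ((q.2 : ℕ) : ℤ) + p.2 * ((M : ℤ) * (N : ℤ))) := by
    intro q p
    simp [e, Int.divModEquiv, hL]
    constructor <;> ring
  have hsum : Summable fun p : ℤ × ℤ => h_dd p.1 p.2 * g p.1 p.2 := by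
    apply summable_of_hasFiniteSupport
    refine hfin.subset ?_
    intro p hp
    exact left_ne_zero_of_mul hp
  have hsum2 : Summable fun c : (Fin L × Fin L) × (ℤ × ℤ) =>
      h_dd (e c).1 (e c).2 * g (e c).1 (e c).2 := e.summable_iff.mpr hsum
  simp only [hF]
  rw [← e.tsum_eq, Summable.tsum_prod hsum2, tsum_fintype,
    Fintype.sum_prod_type, Finset.sum_range]
  refine Finset.sum_congr rfl fun i _ => ?_
  rw [Finset.sum_range]
  refine Finset.sum_congr rfl fun j _ => ?_
  simp only [he, hper]
  rw [tsum_mul_right, ← hh, mul_assoc]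
  simp [hg]
end
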